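/- arXiv:1802.05694 — 6 statements merged into one kernel-verified Lean document; each statement's English description precedes it below -/
import Mathlib

section
/- Let (Ω, 𝓐, ν) be a σ-finite measure space and N ≥ 1. Let p : Fin N → Ω → ℝ be measurable functions with p i x > 0 for ν-a.e. x and ∫ p i dν = 1 for every i, and write S x = ∑ j, p j x. Let D : Ω → Fin N → ℝ be measurable with D x i > 0 and ∑ i, D x i = 1 for all x. Assume that for every i the functions x ↦ p i x * Real.log (D x i) and x ↦ p i x * Real.log (p i x / S x) are ν-integrable. Then -∑ i, ∫ p i x * Real.log (D x i) dν(x) ≥ -∑ i, ∫ p i x * Real.log (p i x / S x) dν(x). (Lemma 1, NLL loss: the discriminator D*_i = p_i/∑_j p_j minimizes the NLL discriminator objective J_D over all discriminators.) -/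
open scoped BigOperators
open MeasureTheory

/-- **Gibbs' inequality** for positive weights `a` and a positive probability vector `q`. -/
theorem sum_mul_log_le_sum_mul_log_div_sum {ι : Type*} [Fintype ι] {a q : ι → ℝ}
    (ha : ∀ i, 0 < a i) (hq : ∀ i, 0 < q i) (hsum : ∑ i, q i = 1) :
    ∑ i, a i * Real.log (q i) ≤ ∑ i, a i * Real.log (a i / ∑ j, a j) := by
  set S := ∑ j, a j with hS
  have key (i : ι) :
      a i * Real.log (q i) ≤ a i * Real.log (a i / S) + (q i * S - a i) := by
    have hSpos : 0 < S := Finset.sum_pos (fun j _ => ha j) ⟨i, Finset.mem_univ i⟩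
    have hdiv : 0 < a i / S := div_pos (ha i) hSpos
    have hlog := Real.log_le_sub_one_of_pos (div_pos (hq i) hdiv)
    rw [Real.log_div (hq i).ne' hdiv.ne'] at hlog
    have hmul := mul_le_mul_of_nonneg_left hlog (ha i).le
    have hcancel : a i * (q i / (a i / S) - 1) = q i * S - a i := by
      have := (ha i).ne'
      field_simp
    linarith
  calc ∑ i, a i * Real.log (q i)
      ≤ ∑ i, (a i * Real.log (a i / S) + (q i * S - a i)) :=
        Finset.sum_le_sum fun i _ => key i
    _ = ∑ i, a i * Real.log (a i / S) := by
        rw [Finset.sum_add_distrib, Finset.sum_sub_distrib, ← Finset.sum_mul, hsum, ← hS]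
        ring

/-- **Lemma 1, NLL loss.**
Let `p i` be ν-densities of the shared feature distributions of `N` domains (positive
a.e., integrating to 1) and let `D` be any discriminator, mapping each point to a
positive probability vector over the `N` domains. Then the NLL discriminator objective
`J_D = -∑ i, ∫ p i * log (D · i) dν` is at least its value at the optimal
discriminator `D*_i = p i / ∑ j, p j`. -/
theorem man_nll_optimal_discriminator
    {Ω : Type*} [MeasurableSpace Ω] (ν : Measure Ω) [SigmaFinite ν]
    (N : ℕ) (hN : 1 ≤ N) (p : Fin N → Ω → ℝ)
    (hpmeas : ∀ i, Measurable (p i))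
    (hppos : ∀ i, ∀ᵐ x ∂ν, 0 < p i x)
    (hpint : ∀ i, ∫ x, p i x ∂ν = 1)
    (D : Ω → Fin N → ℝ)
    (hDmeas : ∀ i, Measurable (fun x => D x i))
    (hDpos : ∀ x i, 0 < D x i)
    (hDsum : ∀ x, ∑ i, D x i = 1)
    (hintD : ∀ i, Integrable (fun x => p i x * Real.log (D x i)) ν)
    (hintP : ∀ i, Integrable (fun x => p i x * Real.log (p i x / ∑ j, p j x)) ν) :
    -∑ i, ∫ x, p i x * Real.log (D x i) ∂ν ≥
      -∑ i, ∫ x, p i x * Real.log (p i x / ∑ j, p j x) ∂ν := by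
  rw [ge_iff_le, neg_le_neg_iff, ← integral_finsetSum _ fun i _ => hintD i,
    ← integral_finsetSum _ fun i _ => hintP i]
  refine integral_mono_ae (integrable_finsetSum _ fun i _ => hintD i)
    (integrable_finsetSum _ fun i _ => hintP i) ?_
  filter_upwards [ae_all_iff.2 hppos] with x hx
  exact sum_mul_log_le_sum_mul_log_div_sum hx (hDpos x) (hDsum x)
end

section
/- Let (Ω, 𝓐, ν) be a σ-finite measure space and N ≥ 1. Let p : Fin N → Ω → ℝ be measurable functions with p i x ≥ 0, ∫ p i dν = 1 for every i, and S x = ∑ j, p j x > 0 for ν-a.e. x. Let D : Ω → Fin N → ℝ be measurable with ∑ i, D x i = 1 for all x, and assume all the integrands below are ν-integrable. Then ∑ i, ∫ p i x * (∑ j, (D x j - (if i = j then 1 else 0))^2) dν(x) ≥ ∑ i, ∫ p i x * (∑ j, (p j x / S x - (if i = j then 1 else 0))^2) dν(x). (Lemma 1, L2 loss: the discriminator D*_i = p_i/∑_j p_j minimizes the least-squares discriminator objective J_D over all discriminators whose outputs lie on the simplex.) -/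
open scoped BigOperators
open MeasureTheory

/-- The weighted mean minimizes the weighted sum of squared deviations. -/
theorem sum_mul_sq_weighted_mean_sub_le {ι : Type*} (s : Finset ι) (w y : ι → ℝ)
    (hw : 0 < ∑ i ∈ s, w i) (c : ℝ) :
    ∑ i ∈ s, w i * ((∑ k ∈ s, w k * y k) / (∑ k ∈ s, w k) - y i) ^ 2 ≤
      ∑ i ∈ s, w i * (c - y i) ^ 2 := by
  have expand (a : ℝ) : ∑ i ∈ s, w i * (a - y i) ^ 2 =
      (∑ i ∈ s, w i) * a ^ 2 - 2 * a * (∑ i ∈ s, w i * y i) + ∑ i ∈ s, w i * y i ^ 2 := by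
    rw [Finset.sum_mul, Finset.mul_sum, ← Finset.sum_sub_distrib, ← Finset.sum_add_distrib]
    exact Finset.sum_congr rfl fun i _ => by ring
  rw [expand, expand]
  set m := (∑ k ∈ s, w k * y k) / (∑ k ∈ s, w k) with hm
  rw [eq_div_iff hw.ne'] at hm
  rw [← hm]
  nlinarith [mul_nonneg hw.le (sq_nonneg (c - m))]

/-- **Lemma 1, L2 loss.**
Let `p i` be ν-densities of the shared feature distributions of `N` domains
(nonnegative, integrating to 1, with a.e. positive sum `S`) and let `D` be any
discriminator whose outputs lie on the simplex (sum to 1 at every point). Then the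
least-squares discriminator objective
`J_D = ∑ i, ∫ p i * ∑ j, (D · j - 1{i=j})² dν` is at least its value at the optimal
discriminator `D*_j = p j / S`. -/
theorem man_l2_optimal_discriminator
    {Ω : Type*} [MeasurableSpace Ω] (ν : Measure Ω) [SigmaFinite ν]
    (N : ℕ) (hN : 1 ≤ N) (p : Fin N → Ω → ℝ)
    (hpmeas : ∀ i, Measurable (p i))
    (hpnonneg : ∀ i x, 0 ≤ p i x)
    (hpint : ∀ i, ∫ x, p i x ∂ν = 1)
    (hSpos : ∀ᵐ x ∂ν, 0 < ∑ j, p j x)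
    (D : Ω → Fin N → ℝ)
    (hDmeas : ∀ i, Measurable (fun x => D x i))
    (hDsum : ∀ x, ∑ i, D x i = 1)
    (hintD : ∀ i, Integrable
      (fun x => p i x * ∑ j, (D x j - (if i = j then (1 : ℝ) else 0)) ^ 2) ν)
    (hintP : ∀ i, Integrable
      (fun x => p i x * ∑ j, (p j x / (∑ k, p k x) - (if i = j then (1 : ℝ) else 0)) ^ 2) ν) :
    ∑ i, ∫ x, p i x * ∑ j, (D x j - (if i = j then (1 : ℝ) else 0)) ^ 2 ∂ν ≥
      ∑ i, ∫ x, p i x * ∑ j, (p j x / (∑ k, p k x) - (if i = j then (1 : ℝ) else 0)) ^ 2 ∂ν := by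
  rw [ge_iff_le, ← integral_finsetSum _ fun i _ => hintP i,
    ← integral_finsetSum _ fun i _ => hintD i]
  refine integral_mono_ae (integrable_finsetSum _ fun i _ => hintP i)
    (integrable_finsetSum _ fun i _ => hintD i) ?_
  filter_upwards [hSpos] with x hx
  simp only [Finset.mul_sum]
  rw [Finset.sum_comm, Finset.sum_comm (f := fun i j => p i x * (D x j - _) ^ 2)]
  refine Finset.sum_le_sum fun j _ => ?_
  simpa using sum_mul_sq_weighted_mean_sub_le Finset.univ (fun i => p i x)
    (fun i => if i = j then (1 : ℝ) else 0) hx (D x j)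
end

section
/- Let (Ω, 𝓐, ν) be a σ-finite measure space and N ≥ 1. Let p : Fin N → Ω → ℝ be measurable with p i x > 0 for ν-a.e. x and ∫ p i dν = 1 for every i. Write S x = ∑ j, p j x and p̄ x = S x / N. Assume that for every i the functions x ↦ p i x * Real.log (p i x / S x) and x ↦ p i x * Real.log (p i x / p̄ x) are ν-integrable. Then ∑ i, ∫ p i x * Real.log (p i x / S x) dν(x) = -(N : ℝ) * Real.log N + ∑ i, ∫ p i x * Real.log (p i x / p̄ x) dν(x). (Theorem 1: when the discriminator is trained to optimality under the NLL loss, -J_{D*} = -N log N + ∑_{i=1}^N KL(P_i ‖ P̄), i.e. -N log N + N·JSD(P_1,…,P_N).) -/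
open scoped BigOperators
open MeasureTheory

/-- **Theorem 1 (NLL loss).**
Let `p i` be ν-densities of the shared feature distributions of `N` domains (positive
a.e., integrating to 1), `S = ∑ j, p j` and `p̄ = S / N` the centroid density. When the
discriminator is trained to optimality under the NLL loss,
`-J_{D*} = ∑ i, ∫ p i * log (p i / S) dν = -N log N + ∑ i, KL(P i ‖ P̄)`,
i.e. `-N log N + N · JSD(P 1, …, P N)`. -/
theorem man_nll_optimal_domain_loss
    {Ω : Type*} [MeasurableSpace Ω] (ν : Measure Ω) [SigmaFinite ν]
    (N : ℕ) (hN : 1 ≤ N) (p : Fin N → Ω → ℝ)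
    (hpmeas : ∀ i, Measurable (p i))
    (hppos : ∀ i, ∀ᵐ x ∂ν, 0 < p i x)
    (hpint : ∀ i, ∫ x, p i x ∂ν = 1)
    (hintS : ∀ i, Integrable (fun x => p i x * Real.log (p i x / ∑ j, p j x)) ν)
    (hintKL : ∀ i, Integrable (fun x => p i x * Real.log (p i x / ((∑ j, p j x) / N))) ν) :
    ∑ i, ∫ x, p i x * Real.log (p i x / ∑ j, p j x) ∂ν =
      -(N : ℝ) * Real.log N +
        ∑ i, ∫ x, p i x * Real.log (p i x / ((∑ j, p j x) / N)) ∂ν := by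
  have hterm : ∀ i, ∫ x, p i x * Real.log (p i x / ∑ j, p j x) ∂ν =
      ∫ x, p i x * Real.log (p i x / ((∑ j, p j x) / N)) ∂ν - Real.log N := by
    intro i
    have hp : Integrable (p i) ν := by
      by_contra h
      simpa [integral_undef h] using hpint i
    have hN0 : (N : ℝ) ≠ 0 := by exact_mod_cast (by omega : N ≠ 0)
    have hae : (fun x => p i x * Real.log (p i x / ∑ j, p j x)) =ᵐ[ν]
        fun x => p i x * Real.log (p i x / ((∑ j, p j x) / N)) - p i x * Real.log N := by
      filter_upwards [ae_all_iff.2 hppos] with x hx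
      have hS : 0 < ∑ j, p j x := Finset.sum_pos (fun j _ => hx j) ⟨i, Finset.mem_univ i⟩
      rw [Real.log_div (hx i).ne' hS.ne', Real.log_div (hx i).ne' (div_ne_zero hS.ne' hN0),
        Real.log_div hS.ne' hN0]
      ring
    rw [integral_congr_ae hae, integral_sub (hintKL i) (hp.mul_const _), integral_mul_const,
      hpint i, one_mul]
  simp only [hterm, Finset.sum_sub_distrib, Finset.sum_const, Finset.card_univ, Fintype.card_fin,
    nsmul_eq_mul]
  ring
end

section
/- Let (Ω, 𝓐) be a measurable space, N ≥ 1, and let μ : Fin N → Measure Ω be probability measures. Set ν = ∑ j, μ j and P̄ = (N : ℝ≥0∞)⁻¹ • ν. Assume the Kullback–Leibler divergence klDiv (μ i) P̄ is finite for every i and that x ↦ Real.log ((∂(μ i)/∂ν) x).toReal is (μ i)-integrable for every i. Then ∑ i, ∫ Real.log ((∂(μ i)/∂ν) x).toReal d(μ i)(x) = -(N : ℝ) * Real.log N + ∑ i, (klDiv (μ i) P̄).toReal. (Theorem 1 in measure-theoretic form: at the optimal NLL discriminator, -J_{D*} = -N log N + ∑_{i=1}^N KL(μ_i ‖ P̄).)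 -/
open scoped BigOperators ENNReal Classical
open MeasureTheory

/-- The Kullback–Leibler divergence between two measures, as an extended real:
`∫ log (dμ/dν) dμ` when `μ ≪ ν` and the log-likelihood ratio is integrable,
and `⊤` otherwise. -/
noncomputable def klDiv {Ω : Type*} [MeasurableSpace Ω] (μ ν : Measure Ω) : EReal :=
  if μ ≪ ν ∧ Integrable (llr μ ν) μ then ((∫ x, llr μ ν x ∂μ : ℝ) : EReal) else ⊤

/-- **Theorem 1 (measure-theoretic form).**
Let `μ i` be the shared-feature distributions of `N` domains (probability measures),
`ν = ∑ j, μ j` and `P̄ = (1/N) ν` their centroid. At the optimal NLL discriminator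
`D*_i = ∂(μ i)/∂ν`, the negated discriminator objective satisfies
`-J_{D*} = ∑ i, ∫ log (∂(μ i)/∂ν) d(μ i) = -N log N + ∑ i, KL(μ i ‖ P̄)`. -/
theorem man_nll_optimal_domain_loss_measure
    {Ω : Type*} [MeasurableSpace Ω]
    (N : ℕ) (hN : 1 ≤ N) (μ : Fin N → Measure Ω)
    [∀ i, IsProbabilityMeasure (μ i)]
    (ν : Measure Ω) (hν : ν = ∑ j, μ j)
    (Pbar : Measure Ω) (hPbar : Pbar = (N : ℝ≥0∞)⁻¹ • ν)
    (hfin : ∀ i, klDiv (μ i) Pbar ≠ ⊤)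
    (hint : ∀ i, Integrable (fun x => Real.log ((μ i).rnDeriv ν x).toReal) (μ i)) :
    ∑ i, ∫ x, Real.log ((μ i).rnDeriv ν x).toReal ∂(μ i) =
      -(N : ℝ) * Real.log N + ∑ i, (klDiv (μ i) Pbar).toReal := by
  subst hν hPbar
  have hN0 : (N : ℝ≥0∞)⁻¹ ≠ 0 := by simp
  have hNtop : (N : ℝ≥0∞)⁻¹ ≠ ∞ := by
    simp only [ne_eq, ENNReal.inv_eq_top, Nat.cast_eq_zero]
    omega
  have hkl : ∀ i, (klDiv (μ i) ((N : ℝ≥0∞)⁻¹ • ∑ j, μ j)).toReal =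
      ∫ x, Real.log ((μ i).rnDeriv (∑ j, μ j) x).toReal ∂(μ i) + Real.log N := by
    intro i
    have hac : μ i ≪ (N : ℝ≥0∞)⁻¹ • ∑ j, μ j ∧
        Integrable (llr (μ i) ((N : ℝ≥0∞)⁻¹ • ∑ j, μ j)) (μ i) := by
      by_contra h
      exact hfin i (if_neg h)
    have hν : μ i ≪ ∑ j, μ j := hac.1.trans Measure.smul_absolutelyContinuous
    rw [klDiv, if_pos hac, EReal.toReal_coe,
      integral_congr_ae (llr_smul_right hν _ hN0 hNtop)]
    have hlog : Real.log ((N : ℝ≥0∞)⁻¹).toReal = -Real.log N := by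
      simp [ENNReal.toReal_inv]
    simp only [hlog, sub_neg_eq_add, llr]
    rw [integral_add (hint i) (integrable_const _)]
    simp
  simp only [hkl, Finset.sum_add_distrib, Finset.sum_const, Finset.card_univ,
    Fintype.card_fin, nsmul_eq_mul]
  ring
end

section
/- Let (Ω, 𝓐, ν) be a σ-finite measure space and N ≥ 1. Let p : Fin N → Ω → ℝ be measurable with p i x ≥ 0, ∫ p i dν = 1 for every i, and S x = ∑ j, p j x > 0 for ν-a.e. x. Write p̄ x = S x / N. Assume all the integrands below are ν-integrable. Then ∑ i, ∫ p i x * (∑ j, (p j x / S x - 1/(N : ℝ))^2) dν(x) = (1/(N : ℝ)) * ∑ i, ∫ (p i x - p̄ x)^2 / p̄ x dν(x). (Theorem 2: when the discriminator is trained to optimality under the L2 loss, the domain loss of the shared feature extractor equals (1/N) ∑_{i=1}^N χ²_Neyman(P_i ‖ P̄).) -/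
open scoped BigOperators
open MeasureTheory

/-- Pointwise form: for a nonzero total `S = ∑ j, a j`, weighting the squared deviations of the
proportions `a j / S` from `1 / N` by the `a i` gives the averaged Neyman χ² summands relative to
the mean `S / N`. -/
lemma sum_mul_sum_sq_div_sum_sub {ι : Type*} [Fintype ι] (a : ι → ℝ) {n : ℝ} (hn : n ≠ 0)
    (ha : ∑ j, a j ≠ 0) :
    ∑ i, a i * ∑ j, (a j / (∑ k, a k) - 1 / n) ^ 2 =
      (1 / n) * ∑ i, (a i - (∑ j, a j) / n) ^ 2 / ((∑ j, a j) / n) := by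
  rw [← Finset.sum_mul, Finset.mul_sum, Finset.mul_sum]
  refine Finset.sum_congr rfl fun i _ => ?_
  field_simp

/-- **Theorem 2 (L2 loss).**
Let `p i` be ν-densities of the shared feature distributions of `N` domains
(nonnegative, integrating to 1, with a.e. positive sum `S`), and `p̄ = S / N` the
centroid density. When the discriminator is trained to its optimum `D*_j = p j / S`
under the L2 loss, the shared extractor's domain loss equals the average Neyman χ²
divergence to the centroid:
`∑ i, ∫ p i * ∑ j, (p j / S - 1/N)² dν = (1/N) ∑ i, ∫ (p i - p̄)² / p̄ dν`. -/
theorem man_l2_optimal_domain_loss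
    {Ω : Type*} [MeasurableSpace Ω] (ν : Measure Ω) [SigmaFinite ν]
    (N : ℕ) (hN : 1 ≤ N) (p : Fin N → Ω → ℝ)
    (hpmeas : ∀ i, Measurable (p i))
    (hpnonneg : ∀ i x, 0 ≤ p i x)
    (hpint : ∀ i, ∫ x, p i x ∂ν = 1)
    (hSpos : ∀ᵐ x ∂ν, 0 < ∑ j, p j x)
    (hintD : ∀ i, Integrable
      (fun x => p i x * ∑ j, (p j x / (∑ k, p k x) - 1 / (N : ℝ)) ^ 2) ν)
    (hintChi : ∀ i, Integrable
      (fun x => (p i x - (∑ j, p j x) / N) ^ 2 / ((∑ j, p j x) / N)) ν) :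
    ∑ i, ∫ x, p i x * ∑ j, (p j x / (∑ k, p k x) - 1 / (N : ℝ)) ^ 2 ∂ν =
      (1 / (N : ℝ)) * ∑ i, ∫ x, (p i x - (∑ j, p j x) / N) ^ 2 / ((∑ j, p j x) / N) ∂ν := by
  have hN' : (N : ℝ) ≠ 0 := by positivity
  rw [← integral_finsetSum _ fun i _ => hintD i, ← integral_finsetSum _ fun i _ => hintChi i,
    ← integral_const_mul]
  refine integral_congr_ae ?_
  filter_upwards [hSpos] with x hx
  exact sum_mul_sum_sq_div_sum_sub (fun i => p i x) hN' hx.ne'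
end

section
/- Let (Ω, 𝓐, ν) be a σ-finite measure space and N ≥ 1. Let p : Fin N → Ω → ℝ be measurable with p i x > 0 for ν-a.e. x and ∫ p i dν = 1 for every i. Write S x = ∑ j, p j x and p̄ x = S x / N, and assume x ↦ p i x * Real.log (p i x / S x) is ν-integrable for every i. Then ∑ i, ∫ p i x * Real.log (p i x / S x) dν(x) ≥ -(N : ℝ) * Real.log N, with equality if and only if for every i, p i x = p̄ x for ν-a.e. x. (Corollary 1, NLL case: the optimum of the shared extractor's domain loss J^D_{F_s} is -N log N, achieved if and only if P_1 = P_2 = ⋯ = P_N = P̄.) -/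
open scoped BigOperators
open MeasureTheory

/-- The pointwise integrand of Gibbs' inequality in terms of `klFun`. -/
lemma mul_klFun_div {a b : ℝ} (hb : b ≠ 0) :
    b * InformationTheory.klFun (a / b) = a * Real.log (a / b) + b - a := by
  rw [InformationTheory.klFun_apply]
  field_simp

section Gibbs

variable {Ω : Type*} [MeasurableSpace Ω] {ν : Measure Ω} {p q : Ω → ℝ}

lemma integral_mul_klFun_div (hq0 : ∀ᵐ x ∂ν, 0 < q x)
    (hp : Integrable p ν) (hq : Integrable q ν) (hpq : ∫ x, p x ∂ν = ∫ x, q x ∂ν)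
    (hint : Integrable (fun x => p x * Real.log (p x / q x)) ν) :
    Integrable (fun x => q x * InformationTheory.klFun (p x / q x)) ν ∧
      ∫ x, q x * InformationTheory.klFun (p x / q x) ∂ν
        = ∫ x, p x * Real.log (p x / q x) ∂ν := by
  have h : (fun x => q x * InformationTheory.klFun (p x / q x))
      =ᵐ[ν] fun x => p x * Real.log (p x / q x) + q x - p x := by
    filter_upwards [hq0] with x hx using mul_klFun_div hx.ne'
  refine ⟨((hint.add hq).sub hp).congr h.symm, ?_⟩
  rw [integral_congr_ae h, integral_sub (by exact hint.add hq) hp, integral_add hint hq, hpq]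
  ring

lemma ae_zero_le_mul_klFun_div (hp0 : ∀ᵐ x ∂ν, 0 < p x) (hq0 : ∀ᵐ x ∂ν, 0 < q x) :
    0 ≤ᵐ[ν] fun x => q x * InformationTheory.klFun (p x / q x) := by
  filter_upwards [hp0, hq0] with x hpx hqx
  exact mul_nonneg hqx.le (InformationTheory.klFun_nonneg (div_pos hpx hqx).le)

/-- **Gibbs' inequality** for densities. -/
lemma integral_mul_log_div_nonneg (hp0 : ∀ᵐ x ∂ν, 0 < p x) (hq0 : ∀ᵐ x ∂ν, 0 < q x)
    (hp : Integrable p ν) (hq : Integrable q ν) (hpq : ∫ x, p x ∂ν = ∫ x, q x ∂ν)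
    (hint : Integrable (fun x => p x * Real.log (p x / q x)) ν) :
    0 ≤ ∫ x, p x * Real.log (p x / q x) ∂ν := by
  rw [← (integral_mul_klFun_div hq0 hp hq hpq hint).2]
  exact integral_nonneg_of_ae (ae_zero_le_mul_klFun_div hp0 hq0)

/-- The equality case of Gibbs' inequality. -/
lemma integral_mul_log_div_eq_zero_iff (hp0 : ∀ᵐ x ∂ν, 0 < p x) (hq0 : ∀ᵐ x ∂ν, 0 < q x)
    (hp : Integrable p ν) (hq : Integrable q ν) (hpq : ∫ x, p x ∂ν = ∫ x, q x ∂ν)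
    (hint : Integrable (fun x => p x * Real.log (p x / q x)) ν) :
    ∫ x, p x * Real.log (p x / q x) ∂ν = 0 ↔ ∀ᵐ x ∂ν, p x = q x := by
  obtain ⟨hi, he⟩ := integral_mul_klFun_div hq0 hp hq hpq hint
  rw [← he, integral_eq_zero_iff_of_nonneg_ae (ae_zero_le_mul_klFun_div hp0 hq0) hi]
  refine Filter.eventually_congr ?_
  filter_upwards [hp0, hq0] with x hpx hqx
  rw [Pi.zero_apply, mul_eq_zero, or_iff_right hqx.ne',
    InformationTheory.klFun_eq_zero_iff (div_pos hpx hqx).le, div_eq_one_iff_eq hqx.ne']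

end Gibbs

/-- **Corollary 1, NLL case.**
Let `p i` be ν-densities of the shared feature distributions of `N` domains (positive
a.e., integrating to 1), `S = ∑ j, p j` and `p̄ = S / N` the centroid density. The
shared extractor's domain loss at the optimal NLL discriminator,
`∑ i, ∫ p i * log (p i / S) dν`, is at least `-N log N`, with equality if and only if
every `p i` agrees ν-a.e. with the centroid density `p̄`
(i.e. `P 1 = P 2 = ⋯ = P N = P̄`). -/
theorem man_nll_corollary
    {Ω : Type*} [MeasurableSpace Ω] (ν : Measure Ω) [SigmaFinite ν]
    (N : ℕ) (hN : 1 ≤ N) (p : Fin N → Ω → ℝ)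
    (hpmeas : ∀ i, Measurable (p i))
    (hppos : ∀ i, ∀ᵐ x ∂ν, 0 < p i x)
    (hpint : ∀ i, ∫ x, p i x ∂ν = 1)
    (hint : ∀ i, Integrable (fun x => p i x * Real.log (p i x / ∑ j, p j x)) ν) :
    (∑ i, ∫ x, p i x * Real.log (p i x / ∑ j, p j x) ∂ν ≥ -(N : ℝ) * Real.log N) ∧
    ((∑ i, ∫ x, p i x * Real.log (p i x / ∑ j, p j x) ∂ν = -(N : ℝ) * Real.log N) ↔
      ∀ i, ∀ᵐ x ∂ν, p i x = (∑ j, p j x) / N) := by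
  have hN0 : (0 : ℝ) < N := by exact_mod_cast hN
  have : Nonempty (Fin N) := ⟨⟨0, hN⟩⟩
  have hp (i) : Integrable (p i) ν :=
    Integrable.of_integral_ne_zero (by rw [hpint i]; exact one_ne_zero)
  have hS : Integrable (fun x => ∑ j, p j x) ν := integrable_finsetSum _ fun i _ => hp i
  have hS0 : ∀ᵐ x ∂ν, 0 < ∑ j, p j x := by
    filter_upwards [ae_all_iff.2 hppos] with x hx
    exact Finset.sum_pos (fun i _ => hx i) Finset.univ_nonempty
  have hq : Integrable (fun x => (∑ j, p j x) / N) ν := hS.div_const _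
  have hq0 : ∀ᵐ x ∂ν, 0 < (∑ j, p j x) / N := by
    filter_upwards [hS0] with x hx using div_pos hx hN0
  have hpq (i) : ∫ x, p i x ∂ν = ∫ x, (∑ j, p j x) / N ∂ν := by
    rw [integral_div, integral_finsetSum _ fun i _ => hp i]
    simp [hpint, hN0.ne']
  have hlog (i) : (fun x => p i x * Real.log (p i x / ((∑ j, p j x) / N)))
      =ᵐ[ν] fun x => p i x * Real.log (p i x / ∑ j, p j x) + p i x * Real.log N := by
    filter_upwards [hppos i, hS0] with x hx hSx
    rw [div_div_eq_mul_div, mul_div_right_comm, Real.log_mul (div_pos hx hSx).ne' hN0.ne',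
      mul_add]
  have hint' (i) : Integrable (fun x => p i x * Real.log (p i x / ((∑ j, p j x) / N))) ν :=
    ((hint i).add ((hp i).mul_const _)).congr (hlog i).symm
  have hval (i) : ∫ x, p i x * Real.log (p i x / ((∑ j, p j x) / N)) ∂ν
      = ∫ x, p i x * Real.log (p i x / ∑ j, p j x) ∂ν + Real.log N := by
    rw [integral_congr_ae (hlog i), integral_add (hint i) ((hp i).mul_const _),
      integral_mul_const, hpint i, one_mul]
  have hsum : ∑ i, ∫ x, p i x * Real.log (p i x / ((∑ j, p j x) / N)) ∂ν
      = ∑ i, ∫ x, p i x * Real.log (p i x / ∑ j, p j x) ∂ν + N * Real.log N := by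
    simp [hval, Finset.sum_add_distrib]
  have hnn (i) : 0 ≤ ∫ x, p i x * Real.log (p i x / ((∑ j, p j x) / N)) ∂ν :=
    integral_mul_log_div_nonneg (hppos i) hq0 (hp i) hq (hpq i) (hint' i)
  refine ⟨?_, ?_⟩
  · have := Finset.sum_nonneg fun i (_ : i ∈ Finset.univ) => hnn i
    linarith
  · rw [neg_mul, ← add_eq_zero_iff_eq_neg, ← hsum,
      Finset.sum_eq_zero_iff_of_nonneg fun i _ => hnn i]
    simp only [Finset.mem_univ, true_imp_iff]
    exact forall_congr' fun i =>
      integral_mul_log_div_eq_zero_iff (hppos i) hq0 (hp i) hq (hpq i) (hint' i)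
end
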